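/- Let N₁, N₂, N₃, R be positive integers, let X ∈ ℝ^{N₁×N₂×N₃} be a tensor such that U_R(X) is nonempty, let p ≥ 1 and α > 0. If u ∈ U_R(X) attains the infimum over U_R(X) of (1/3)·Σ_{r=1}^R Σ_{d=1}^3 ‖u_r^{(d)}‖_p^α, then for every r ∈ {1,…,R} and every d ∈ {1,2,3}, ‖u_r^{(d)}‖_p = (‖u_r^{(1)}‖_p · ‖u_r^{(2)}‖_p · ‖u_r^{(3)}‖_p)^{1/3}. -/

import Mathlib

open Finset

/-- The vector ℓ_p norm on `ℝ^n`. -/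
noncomputable def vecLpNorm (p : ℝ) {n : ℕ} (v : Fin n → ℝ) : ℝ :=
  (∑ i, |v i| ^ p) ^ (1 / p)

/-- `u = (u1, u2, u3)` is a rank-`R` CP decomposition of the tensor `X`. -/
def IsCPDecomp {N₁ N₂ N₃ R : ℕ} (X : Fin N₁ × Fin N₂ × Fin N₃ → ℝ)
    (u1 : Fin R → Fin N₁ → ℝ) (u2 : Fin R → Fin N₂ → ℝ)
    (u3 : Fin R → Fin N₃ → ℝ) : Prop :=
  ∀ i j k, X (i, j, k) = ∑ r, u1 r i * u2 r j * u3 r k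

lemma vecLpNorm_nonneg (p : ℝ) {n : ℕ} (v : Fin n → ℝ) : 0 ≤ vecLpNorm p v :=
  Real.rpow_nonneg (Finset.sum_nonneg fun _ _ => Real.rpow_nonneg (abs_nonneg _) _) _

lemma vecLpNorm_zero {p : ℝ} (hp : p ≠ 0) {n : ℕ} : vecLpNorm p (0 : Fin n → ℝ) = 0 := by
  simp [vecLpNorm, Real.zero_rpow hp, Real.zero_rpow (inv_ne_zero hp)]

lemma eq_zero_of_vecLpNorm_eq_zero {p : ℝ} (hp : p ≠ 0) {n : ℕ} {v : Fin n → ℝ}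
    (h : vecLpNorm p v = 0) : v = 0 := by
  have hnn : ∀ i ∈ Finset.univ, 0 ≤ |v i| ^ p := fun i _ => Real.rpow_nonneg (abs_nonneg _) _
  rw [vecLpNorm, Real.rpow_eq_zero (Finset.sum_nonneg hnn) (one_div_ne_zero hp),
    Finset.sum_eq_zero_iff_of_nonneg hnn] at h
  ext i
  simpa using (Real.rpow_eq_zero (abs_nonneg _) hp).1 (h i (Finset.mem_univ i))

lemma vecLpNorm_smul {p : ℝ} (hp : p ≠ 0) {n : ℕ} {c : ℝ} (hc : 0 ≤ c) (v : Fin n → ℝ) :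
    vecLpNorm p (c • v) = c * vecLpNorm p v := by
  have hnn : 0 ≤ ∑ i, |v i| ^ p :=
    Finset.sum_nonneg fun i _ => Real.rpow_nonneg (abs_nonneg _) _
  have h : ∑ i, |(c • v) i| ^ p = c ^ p * ∑ i, |v i| ^ p := by
    rw [Finset.mul_sum]
    refine Finset.sum_congr rfl fun i _ => ?_
    rw [Pi.smul_apply, smul_eq_mul, abs_mul, abs_of_nonneg hc, Real.mul_rpow hc (abs_nonneg _)]
  rw [vecLpNorm, vecLpNorm, h, Real.mul_rpow (Real.rpow_nonneg hc _) hnn, ← Real.rpow_mul hc,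
    mul_one_div_cancel hp, Real.rpow_one]

/-- Replacing one rank-one term of a CP decomposition by another factorization of the same
rank-one tensor yields a CP decomposition. -/
lemma IsCPDecomp.update {N₁ N₂ N₃ R : ℕ} {X : Fin N₁ × Fin N₂ × Fin N₃ → ℝ}
    {u1 : Fin R → Fin N₁ → ℝ} {u2 : Fin R → Fin N₂ → ℝ} {u3 : Fin R → Fin N₃ → ℝ}
    (hu : IsCPDecomp X u1 u2 u3) (r : Fin R)
    {w1 : Fin N₁ → ℝ} {w2 : Fin N₂ → ℝ} {w3 : Fin N₃ → ℝ}
    (hw : ∀ i j k, w1 i * w2 j * w3 k = u1 r i * u2 r j * u3 r k) :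
    IsCPDecomp X (Function.update u1 r w1) (Function.update u2 r w2)
      (Function.update u3 r w3) := by
  intro i j k
  rw [hu i j k]
  refine Finset.sum_congr rfl fun s _ => ?_
  obtain rfl | hs := eq_or_ne s r
  · simp [hw]
  · simp [hs]

/-- The equality case of the AM-GM inequality for three positive reals. -/
lemma eq_and_eq_of_sum_pow_three_le {x y z : ℝ} (hx : 0 < x) (hy : 0 < y) (hz : 0 < z)
    (h : x ^ 3 + y ^ 3 + z ^ 3 ≤ 3 * (x * y * z)) : x = y ∧ y = z := by
  have hs : (x - y) ^ 2 + (y - z) ^ 2 + (x - z) ^ 2 ≤ 0 := by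
    by_contra! hlt
    nlinarith [mul_pos (add_pos (add_pos hx hy) hz) hlt]
  constructor <;> nlinarith [sq_nonneg (x - y), sq_nonneg (y - z), sq_nonneg (x - z)]

/-- If positive `a`, `b`, `c` have sum of `α`-th powers at most three times the `α`-th power of
their geometric mean, then they are all equal. -/
lemma eq_and_eq_of_sum_rpow_le {a b c α : ℝ} (ha : 0 < a) (hb : 0 < b) (hc : 0 < c)
    (hα : α ≠ 0)
    (h : a ^ α + b ^ α + c ^ α ≤ 3 * ((a * b * c) ^ ((1 : ℝ) / 3)) ^ α) : a = b ∧ b = c := by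
  have hcube : ∀ {t : ℝ}, 0 < t → t ^ α = (t ^ (α / 3)) ^ 3 := fun {t} ht => by
    rw [← Real.rpow_mul_natCast ht.le]
    congr 1
    push_cast
    ring
  have hg : ((a * b * c) ^ ((1 : ℝ) / 3)) ^ α = a ^ (α / 3) * b ^ (α / 3) * c ^ (α / 3) := by
    rw [← Real.rpow_mul (by positivity), ← Real.mul_rpow ha.le hb.le,
      ← Real.mul_rpow (by positivity) hc.le]
    congr 1
    ring
  rw [hcube ha, hcube hb, hcube hc, hg] at h
  have hα3 : α / 3 ≠ 0 := by positivity
  obtain ⟨h1, h2⟩ := eq_and_eq_of_sum_pow_three_le (Real.rpow_pos_of_pos ha _)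
    (Real.rpow_pos_of_pos hb _) (Real.rpow_pos_of_pos hc _) h
  exact ⟨(Real.rpow_left_inj ha.le hb.le hα3).1 h1, (Real.rpow_left_inj hb.le hc.le hα3).1 h2⟩

theorem stmt_1 {N₁ N₂ N₃ R : ℕ} (hN₁ : 0 < N₁) (hN₂ : 0 < N₂) (hN₃ : 0 < N₃)
    (hR : 0 < R) (X : Fin N₁ × Fin N₂ × Fin N₃ → ℝ) (p α : ℝ) (hp : 1 ≤ p) (hα : 0 < α)
    (u1 : Fin R → Fin N₁ → ℝ) (u2 : Fin R → Fin N₂ → ℝ) (u3 : Fin R → Fin N₃ → ℝ)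
    (hu : IsCPDecomp X u1 u2 u3)
    (hmin : ∀ (v1 : Fin R → Fin N₁ → ℝ) (v2 : Fin R → Fin N₂ → ℝ)
      (v3 : Fin R → Fin N₃ → ℝ), IsCPDecomp X v1 v2 v3 →
      (1 / 3) * ∑ r, (vecLpNorm p (u1 r) ^ α + vecLpNorm p (u2 r) ^ α
          + vecLpNorm p (u3 r) ^ α) ≤
      (1 / 3) * ∑ r, (vecLpNorm p (v1 r) ^ α + vecLpNorm p (v2 r) ^ α
          + vecLpNorm p (v3 r) ^ α)) :
    ∀ r : Fin R,
      vecLpNorm p (u1 r)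
        = (vecLpNorm p (u1 r) * vecLpNorm p (u2 r) * vecLpNorm p (u3 r)) ^ ((1 : ℝ) / 3) ∧
      vecLpNorm p (u2 r)
        = (vecLpNorm p (u1 r) * vecLpNorm p (u2 r) * vecLpNorm p (u3 r)) ^ ((1 : ℝ) / 3) ∧
      vecLpNorm p (u3 r)
        = (vecLpNorm p (u1 r) * vecLpNorm p (u2 r) * vecLpNorm p (u3 r)) ^ ((1 : ℝ) / 3) := by
  intro r
  have hp0 : p ≠ 0 := by positivity
  have hloc : ∀ (w1 : Fin N₁ → ℝ) (w2 : Fin N₂ → ℝ) (w3 : Fin N₃ → ℝ),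
      (∀ i j k, w1 i * w2 j * w3 k = u1 r i * u2 r j * u3 r k) →
      vecLpNorm p (u1 r) ^ α + vecLpNorm p (u2 r) ^ α + vecLpNorm p (u3 r) ^ α ≤
        vecLpNorm p w1 ^ α + vecLpNorm p w2 ^ α + vecLpNorm p w3 ^ α := by
    intro w1 w2 w3 hw
    have h := le_of_mul_le_mul_left (hmin _ _ _ (hu.update r hw)) (by norm_num)
    rw [← Finset.add_sum_erase _ _ (Finset.mem_univ r),
      ← Finset.add_sum_erase _ _ (Finset.mem_univ r)] at h
    simp only [Function.update_self] at h
    refine le_of_add_le_add_right (h.trans_eq (congrArg _ (Finset.sum_congr rfl fun s hs => ?_)))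
    simp only [Function.update_of_ne (Finset.ne_of_mem_erase hs)]
  have ha := vecLpNorm_nonneg p (u1 r)
  have hb := vecLpNorm_nonneg p (u2 r)
  have hc := vecLpNorm_nonneg p (u3 r)
  by_cases h0 : vecLpNorm p (u1 r) = 0 ∨ vecLpNorm p (u2 r) = 0 ∨ vecLpNorm p (u3 r) = 0
  · have h := hloc 0 0 0 fun i j k => by
      rcases h0 with h | h | h <;> simp [eq_zero_of_vecLpNorm_eq_zero hp0 h]
    simp only [vecLpNorm_zero hp0, Real.zero_rpow hα.ne', add_zero] at h
    have ha' := Real.rpow_nonneg ha α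
    have hb' := Real.rpow_nonneg hb α
    have hc' := Real.rpow_nonneg hc α
    have ha0 := (Real.rpow_eq_zero ha hα.ne').1 (by linarith)
    have hb0 := (Real.rpow_eq_zero hb hα.ne').1 (by linarith)
    have hc0 := (Real.rpow_eq_zero hc hα.ne').1 (by linarith)
    simp [ha0, hb0, hc0]
  · push Not at h0
    obtain ⟨ha0, hb0, hc0⟩ := h0
    set a := vecLpNorm p (u1 r) with ha_def
    set b := vecLpNorm p (u2 r) with hb_def
    set c := vecLpNorm p (u3 r) with hc_def
    set g := (a * b * c) ^ ((1 : ℝ) / 3) with hg_def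
    have hg : 0 ≤ g := by positivity
    have hg3 : g ^ 3 = a * b * c := by
      rw [hg_def, ← Real.rpow_mul_natCast (by positivity)]
      norm_num
    have h := hloc ((g / a) • u1 r) ((g / b) • u2 r) ((g / c) • u3 r) fun i j k => by
      have hprod : g / a * (g / b) * (g / c) = 1 := by
        field_simp
        exact hg3
      simp only [Pi.smul_apply, smul_eq_mul]
      linear_combination u1 r i * u2 r j * u3 r k * hprod
    rw [vecLpNorm_smul hp0 (by positivity), vecLpNorm_smul hp0 (by positivity),
      vecLpNorm_smul hp0 (by positivity), ← ha_def, ← hb_def, ← hc_def, div_mul_cancel₀ _ ha0,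
      div_mul_cancel₀ _ hb0, div_mul_cancel₀ _ hc0] at h
    obtain ⟨hab, hbc⟩ := eq_and_eq_of_sum_rpow_le (ha.lt_of_ne' ha0) (hb.lt_of_ne' hb0)
      (hc.lt_of_ne' hc0) hα.ne' (h.trans_eq (by ring))
    have hga : g = a := by
      rw [← hab.trans hbc, ← hab] at hg3
      exact (pow_left_inj₀ hg ha three_ne_zero).1 (hg3.trans (by ring))
    exact ⟨hga.symm, (hga.trans hab).symm, (hga.trans (hab.trans hbc)).symm⟩
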